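/- For every integer n ≥ 4 and every d ≥ 0, the dimension over ℂ of the space I_{n,d} equals the number of admissible partitions λ ∈ π_{n,d}. -/

import Mathlib

open MvPolynomial Finset

/-- A partition with `n` (possibly zero) parts, encoded as a weakly decreasing function
`ℕ → ℕ` (0-indexed: the parts are `l 0 ≥ l 1 ≥ ⋯ ≥ l (n-1)`) vanishing from index `n` on. -/
def PartitionN (n : ℕ) (l : ℕ → ℕ) : Prop :=
  Antitone l ∧ ∀ j, n ≤ j → l j = 0

/-- A multiset of exponents of the form `{i, i}` (i.e. `e_i²`) or `{i, i+1}` (i.e. `e_i e_{i+1}`). -/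
def GoodPair (P : Multiset ℕ) : Prop := ∃ i : ℕ, P = {i, i} ∨ P = {i, i + 1}

/-- The partition `l` (with `n` parts) is non-admissible: the monomial `e_l = ∏ e_{l m}`
is divisible by a product `m₁ · m₂` of two factors each of the form `e_i²` or `e_j e_{j+1}`,
or by a monomial `e_i³ e_{i+2}`.  Divisibility of monomials is expressed as multiset
containment of the exponent multisets. -/
def NonAdmissible (n : ℕ) (l : ℕ → ℕ) : Prop :=
  (∃ P Q : Multiset ℕ, GoodPair P ∧ GoodPair Q ∧ P + Q ≤ (Finset.range n).val.map l) ∨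
  (∃ i : ℕ, ({i, i, i, i + 2} : Multiset ℕ) ≤ (Finset.range n).val.map l)

def Admissible (n : ℕ) (l : ℕ → ℕ) : Prop := ¬ NonAdmissible n l

/-- The number of admissible partitions in `π_{n,d}`. -/
noncomputable def admCount (n d : ℕ) : ℕ :=
  Set.ncard {l : ℕ → ℕ | PartitionN n l ∧ (∑ j ∈ Finset.range n, l j) = d ∧ Admissible n l}

/-- The ideal `I_n` (degree-`d` component): symmetric polynomials in `n` variables over `ℂ`
vanishing under the substitution `x₂ := x₁`, `x₄ := x₃`, homogeneous of degree `d`. -/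
noncomputable def IComponent (n : ℕ) (hn : 4 ≤ n) (d : ℕ) :
    Submodule ℂ (MvPolynomial (Fin n) ℂ) :=
  (Subalgebra.toSubmodule (MvPolynomial.symmetricSubalgebra (Fin n) ℂ) :
      Submodule ℂ (MvPolynomial (Fin n) ℂ)) ⊓
  LinearMap.ker (MvPolynomial.aeval (R := ℂ)
      (fun i : Fin n => if (i : ℕ) = 1 then X (⟨0, by omega⟩ : Fin n)
        else if (i : ℕ) = 3 then X (⟨2, by omega⟩ : Fin n)
        else (X i : MvPolynomial (Fin n) ℂ))).toLinearMap ⊓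
  MvPolynomial.homogeneousSubmodule (Fin n) ℂ d

section UpperBound

variable {m : ℕ}

theorem fin_first_four_ne (m : ℕ) :
    (0 : Fin (m + 4)) ≠ 1 ∧ (0 : Fin (m + 4)) ≠ 2 ∧ (0 : Fin (m + 4)) ≠ 3 ∧
      (1 : Fin (m + 4)) ≠ 2 ∧ (1 : Fin (m + 4)) ≠ 3 ∧ (2 : Fin (m + 4)) ≠ 3 := by
  have h2 : 2 % (m + 4) = 2 := Nat.mod_eq_of_lt (by omega)
  have h3 : 3 % (m + 4) = 3 := Nat.mod_eq_of_lt (by omega)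
  simp [Fin.ext_iff, h2, h3]

/-- The substitution of indices `1 ↦ 0`, `3 ↦ 2`. -/
def pairMap (m : ℕ) (i : Fin (m + 4)) : Fin (m + 4) :=
  if i = 1 then 0 else if i = 3 then 2 else i

theorem coeff_mapDomain_of_isSymmetric {σ : Type*} {f : MvPolynomial σ ℂ} (hf : f.IsSymmetric)
    (e : Equiv.Perm σ) (s : σ →₀ ℕ) : coeff (s.mapDomain e) f = coeff s f := by
  conv_lhs => rw [← hf e]
  exact coeff_rename_mapDomain _ e.injective _ _

theorem mapDomain_pairMap_apply (s : Fin (m + 4) →₀ ℕ) (j : Fin (m + 4)) :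
    s.mapDomain (pairMap m) j = ∑ i, if pairMap m i = j then s i else 0 := by
  rw [Finsupp.mapDomain, Finsupp.sum_fintype _ _ (by simp), Finsupp.finsetSum_apply]
  simp only [Finsupp.single_apply]

theorem mapDomain_pairMap_zero (s : Fin (m + 4) →₀ ℕ) :
    s.mapDomain (pairMap m) 0 = s 0 + s 1 := by
  obtain ⟨n01, n02, n03, n12, n13, n23⟩ := fin_first_four_ne m
  have h : ∀ i, pairMap m i = 0 ↔ i = 0 ∨ i = 1 := by
    intro i
    unfold pairMap
    grind
  simp only [mapDomain_pairMap_apply, h, ← Finset.sum_filter]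
  rw [← Finset.sum_pair n01]
  congr 1
  ext i
  simp

theorem mapDomain_pairMap_two (s : Fin (m + 4) →₀ ℕ) :
    s.mapDomain (pairMap m) 2 = s 2 + s 3 := by
  obtain ⟨n01, n02, n03, n12, n13, n23⟩ := fin_first_four_ne m
  have h : ∀ i, pairMap m i = 2 ↔ i = 2 ∨ i = 3 := by
    intro i
    unfold pairMap
    grind
  simp only [mapDomain_pairMap_apply, h, ← Finset.sum_filter]
  rw [← Finset.sum_pair n23]
  congr 1
  ext i
  simp

theorem mapDomain_pairMap_of_ne (s : Fin (m + 4) →₀ ℕ) {j : Fin (m + 4)}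
    (h0 : j ≠ 0) (h1 : j ≠ 1) (h2 : j ≠ 2) (h3 : j ≠ 3) :
    s.mapDomain (pairMap m) j = s j := by
  have h : ∀ i, pairMap m i = j ↔ i = j := by
    intro i
    unfold pairMap
    grind
  simp [mapDomain_pairMap_apply, h]

theorem coeff_rename_eq_sum {σ τ : Type*} [DecidableEq τ] (g : σ → τ) (f : MvPolynomial σ ℂ)
    (u : τ →₀ ℕ) :
    coeff u (rename g f) = ∑ s ∈ f.support with s.mapDomain g = u, coeff s f := by
  conv_lhs => rw [f.as_sum]
  rw [map_sum, coeff_sum, Finset.sum_filter]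
  simp only [rename_monomial, coeff_monomial]

theorem mapDomain_swap_apply {σ : Type*} [DecidableEq σ] (s : σ →₀ ℕ) (a b j : σ) :
    s.mapDomain (Equiv.swap a b) j = if j = a then s b else if j = b then s a else s j := by
  rw [Finsupp.mapDomain_equiv_apply, Equiv.symm_swap, Equiv.swap_apply_def]
  split_ifs <;> rfl

theorem coeff_eq_zero_of_fiber {f : MvPolynomial (Fin (m + 4)) ℂ} (hf : f.IsSymmetric)
    (h0 : rename (pairMap m) f = 0) (s : Fin (m + 4) →₀ ℕ)
    (H : ∀ s' : Fin (m + 4) →₀ ℕ, s' 0 + s' 1 = s 0 + s 1 → s' 2 + s' 3 = s 2 + s 3 →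
      (∀ j, j ≠ 0 → j ≠ 1 → j ≠ 2 → j ≠ 3 → s' j = s j) → coeff s' f ≠ 0 →
      (s' 0 = s 0 ∨ s' 0 = s 1) ∧ (s' 2 = s 2 ∨ s' 2 = s 3)) :
    coeff s f = 0 := by
  by_contra hs
  have h := coeff_rename_eq_sum (pairMap m) f (s.mapDomain (pairMap m))
  rw [h0, coeff_zero] at h
  have key : ∀ s' ∈ f.support.filter (fun s' => s'.mapDomain (pairMap m) =
      s.mapDomain (pairMap m)), coeff s' f = coeff s f := by
    intro s' hs'
    rw [Finset.mem_filter, mem_support_iff] at hs'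
    obtain ⟨hne, he⟩ := hs'
    have e0 := DFunLike.congr_fun he 0
    have e2 := DFunLike.congr_fun he 2
    rw [mapDomain_pairMap_zero, mapDomain_pairMap_zero] at e0
    rw [mapDomain_pairMap_two, mapDomain_pairMap_two] at e2
    have ej : ∀ j, j ≠ 0 → j ≠ 1 → j ≠ 2 → j ≠ 3 → s' j = s j := by
      intro j j0 j1 j2 j3
      simpa only [mapDomain_pairMap_of_ne _ j0 j1 j2 j3] using DFunLike.congr_fun he j
    obtain ⟨h1, h2⟩ := H s' e0 e2 ej hne
    obtain ⟨n01, n02, n03, n12, n13, n23⟩ := fin_first_four_ne m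
    rcases h1 with h1 | h1 <;> rcases h2 with h2 | h2
    · congr 1
      ext j
      grind
    · rw [← coeff_mapDomain_of_isSymmetric hf (Equiv.swap 2 3)]
      congr 1
      ext j
      rw [mapDomain_swap_apply]
      grind
    · rw [← coeff_mapDomain_of_isSymmetric hf (Equiv.swap 0 1)]
      congr 1
      ext j
      rw [mapDomain_swap_apply]
      grind
    · rw [← coeff_mapDomain_of_isSymmetric hf (Equiv.swap 0 1),
        ← coeff_mapDomain_of_isSymmetric hf (Equiv.swap 2 3)]
      congr 1
      ext j
      simp only [mapDomain_swap_apply]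
      grind
  rw [Finset.sum_congr rfl key, Finset.sum_const] at h
  have hm : s ∈ f.support.filter (fun s' => s'.mapDomain (pairMap m) =
      s.mapDomain (pairMap m)) := by simp [hs]
  have := Finset.card_pos.2 ⟨s, hm⟩
  rw [eq_comm, smul_eq_zero] at h
  rcases h with h | h
  · omega
  · exact hs h

/-- A strictly convex symmetric weight on exponents; it strictly grows when two exponents are
moved apart, and it separates `{i, i, i, i + 2}` from the wider multisets of the same sum. -/
noncomputable def weight {n : ℕ} (s : Fin n →₀ ℕ) : ℚ := ∑ j, (1 / 2 : ℚ) ^ s j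

theorem weight_mapDomain {n : ℕ} (g : Equiv.Perm (Fin n)) (s : Fin n →₀ ℕ) :
    weight (s.mapDomain g) = weight s := by
  simp only [weight, Finsupp.mapDomain_equiv_apply]
  exact Equiv.sum_comp g.symm fun j => (1 / 2 : ℚ) ^ s j

theorem sum_four_le_of_weight_le {s s' : Fin (m + 4) →₀ ℕ}
    (hs : ∀ j, j ≠ 0 → j ≠ 1 → j ≠ 2 → j ≠ 3 → s' j = s j) (hw : weight s' ≤ weight s) :
    (1 / 2 : ℚ) ^ s' 0 + (1 / 2) ^ s' 1 + (1 / 2) ^ s' 2 + (1 / 2) ^ s' 3 ≤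
      (1 / 2) ^ s 0 + (1 / 2) ^ s 1 + (1 / 2) ^ s 2 + (1 / 2) ^ s 3 := by
  obtain ⟨n01, n02, n03, n12, n13, n23⟩ := fin_first_four_ne m
  have split : ∀ u : Fin (m + 4) →₀ ℕ, weight u =
      ((1 / 2 : ℚ) ^ u 0 + (1 / 2) ^ u 1 + (1 / 2) ^ u 2 + (1 / 2) ^ u 3) +
        ∑ j ∈ ({0, 1, 2, 3} : Finset (Fin (m + 4)))ᶜ, (1 / 2 : ℚ) ^ u j := by
    intro u
    rw [weight, ← Finset.sum_add_sum_compl {0, 1, 2, 3}, Finset.sum_insert (by simp [*]),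
      Finset.sum_insert (by simp [*]), Finset.sum_pair n23]
    ring
  rw [split, split s] at hw
  have : ∑ j ∈ ({0, 1, 2, 3} : Finset (Fin (m + 4)))ᶜ, (1 / 2 : ℚ) ^ s' j =
      ∑ j ∈ ({0, 1, 2, 3} : Finset (Fin (m + 4)))ᶜ, (1 / 2 : ℚ) ^ s j := by
    refine Finset.sum_congr rfl fun j hj => ?_
    simp only [Finset.mem_compl, Finset.mem_insert, Finset.mem_singleton, not_or] at hj
    rw [hs j hj.1 hj.2.1 hj.2.2.1 hj.2.2.2]
  linarith

theorem half_pow_add_lt {a b c e : ℕ} (hce : c ≤ e) (ha : a < c) :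
    (1 / 2 : ℚ) ^ c + (1 / 2) ^ e < (1 / 2) ^ a + (1 / 2) ^ b := by
  have h1 : (1 / 2 : ℚ) ^ e ≤ (1 / 2) ^ c :=
    pow_le_pow_of_le_one (by norm_num) (by norm_num) hce
  have h2 : (1 / 2 : ℚ) ^ c ≤ (1 / 2) ^ (a + 1) :=
    pow_le_pow_of_le_one (by norm_num) (by norm_num) ha
  have h3 : (0 : ℚ) < (1 / 2) ^ b := by positivity
  rw [pow_succ] at h2
  linarith

theorem half_pow_add_le {a b c e : ℕ} (h : a + b = c + e) (hce : c ≤ e) (hec : e ≤ c + 1) :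
    (1 / 2 : ℚ) ^ c + (1 / 2) ^ e ≤ (1 / 2) ^ a + (1 / 2) ^ b ∧
      ((1 / 2 : ℚ) ^ a + (1 / 2) ^ b ≤ (1 / 2) ^ c + (1 / 2) ^ e → a = c ∨ a = e) := by
  rcases lt_or_ge a c with hac | hac
  · have := half_pow_add_lt (b := b) hce hac
    exact ⟨this.le, fun h' => absurd h' (not_le.2 this)⟩
  rcases lt_or_ge b c with hbc | hbc
  · have := half_pow_add_lt (b := a) hce hbc
    rw [add_comm ((1 / 2 : ℚ) ^ b)] at this
    exact ⟨this.le, fun h' => absurd h' (not_le.2 this)⟩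
  have hae : a = c ∧ b = e ∨ a = e ∧ b = c := by omega
  rcases hae with ⟨rfl, rfl⟩ | ⟨rfl, rfl⟩
  · exact ⟨le_rfl, fun _ => Or.inl rfl⟩
  · exact ⟨(add_comm _ _).le, fun _ => Or.inr rfl⟩

/-- The gap between `2⁻ᵃ` and its secant through `i` and `i + 1`. -/
theorem half_pow_sub_secant (i a : ℕ) :
    0 ≤ (1 / 2 : ℚ) ^ a - (1 / 2) ^ i * (1 - ((a : ℚ) - i) / 2) ∧
    ((a = i ∨ a = i + 1) ∨
      (a = i + 2 ∧
        (1 / 2 : ℚ) ^ i / 4 ≤ (1 / 2 : ℚ) ^ a - (1 / 2) ^ i * (1 - ((a : ℚ) - i) / 2)) ∨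
      (1 / 2 : ℚ) ^ i / 4 < (1 / 2 : ℚ) ^ a - (1 / 2) ^ i * (1 - ((a : ℚ) - i) / 2)) := by
  rcases lt_or_ge a i with h | h
  · obtain ⟨k, rfl⟩ : ∃ k, i = a + k + 1 := ⟨i - a - 1, by omega⟩
    have hk : ((k : ℚ) + 2) * (1 / 2) ^ (k + 1) ≤ 1 := by
      have : ((k + 1 : ℕ) : ℚ) + 1 ≤ 2 ^ (k + 1) := by
        exact_mod_cast (Nat.lt_two_pow_self (n := k + 1))
      rw [one_div, inv_pow, mul_inv_le_iff₀ (by positivity)]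
      push_cast at this
      linarith
    have hp : (0 : ℚ) < (1 / 2) ^ a := by positivity
    have hq : (0 : ℚ) < (1 / 2) ^ (k + 1) := by positivity
    have e : (1 / 2 : ℚ) ^ (a + k + 1) = (1 / 2) ^ a * (1 / 2) ^ (k + 1) := by
      rw [← pow_add, add_assoc]
    have hpq := mul_pos hp hq
    have hkq : (0 : ℚ) ≤ k * ((1 / 2) ^ a * (1 / 2) ^ (k + 1)) := by positivity
    have := mul_le_mul_of_nonneg_left hk hp.le
    rw [e]
    push_cast
    refine ⟨by nlinarith, Or.inr (Or.inr (by nlinarith))⟩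
  · obtain ⟨k, rfl⟩ := Nat.exists_eq_add_of_le h
    have hp : (0 : ℚ) < (1 / 2) ^ i := by positivity
    rw [pow_add]
    push_cast
    rcases k with _ | _ | _ | k
    · simp
    · exact ⟨by norm_num, Or.inl (Or.inr rfl)⟩
    · exact ⟨by norm_num, Or.inr (Or.inl ⟨rfl, by norm_num; linarith⟩)⟩
    · have hq : (0 : ℚ) < (1 / 2) ^ i * (1 / 2) ^ (k + 3) := by positivity
      have hkq : (0 : ℚ) ≤ k * (1 / 2) ^ i := by positivity
      push_cast
      exact ⟨by nlinarith, Or.inr (Or.inr (by nlinarith))⟩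

theorem cases_of_half_pow_sum_le {a b c e i : ℕ} (h : a + b + c + e = 4 * i + 2)
    (hw : (1 / 2 : ℚ) ^ a + (1 / 2) ^ b + (1 / 2) ^ c + (1 / 2) ^ e ≤
      3 * (1 / 2) ^ i + (1 / 2) ^ (i + 2)) :
    ((a = i ∨ a = i + 1) ∧ (b = i ∨ b = i + 1) ∧ (c = i ∨ c = i + 1) ∧ (e = i ∨ e = i + 1)) ∨
    (a = i + 2 ∧ b = i ∧ c = i ∧ e = i) ∨ (b = i + 2 ∧ a = i ∧ c = i ∧ e = i) ∨
    (c = i + 2 ∧ a = i ∧ b = i ∧ e = i) ∨ (e = i + 2 ∧ a = i ∧ b = i ∧ c = i) := by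
  have hp : (0 : ℚ) < (1 / 2) ^ i / 4 := by positivity
  have hq : (a : ℚ) + b + c + e = 4 * i + 2 := by exact_mod_cast h
  obtain ⟨a1, a2⟩ := half_pow_sub_secant i a
  obtain ⟨b1, b2⟩ := half_pow_sub_secant i b
  obtain ⟨c1, c2⟩ := half_pow_sub_secant i c
  obtain ⟨e1, e2⟩ := half_pow_sub_secant i e
  have hsum : ((1 / 2 : ℚ) ^ a - (1 / 2) ^ i * (1 - ((a : ℚ) - i) / 2)) +
      ((1 / 2 : ℚ) ^ b - (1 / 2) ^ i * (1 - ((b : ℚ) - i) / 2)) +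
      ((1 / 2 : ℚ) ^ c - (1 / 2) ^ i * (1 - ((c : ℚ) - i) / 2)) +
      ((1 / 2 : ℚ) ^ e - (1 / 2) ^ i * (1 - ((e : ℚ) - i) / 2)) ≤ (1 / 2) ^ i / 4 := by
    have : (1 / 2 : ℚ) ^ i * ((a : ℚ) + b + c + e) = (1 / 2) ^ i * (4 * i + 2) := by rw [hq]
    rw [pow_add] at hw
    linarith
  generalize (1 / 2 : ℚ) ^ a - (1 / 2) ^ i * (1 - ((a : ℚ) - i) / 2) = A at *
  generalize (1 / 2 : ℚ) ^ b - (1 / 2) ^ i * (1 - ((b : ℚ) - i) / 2) = B at *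
  generalize (1 / 2 : ℚ) ^ c - (1 / 2) ^ i * (1 - ((c : ℚ) - i) / 2) = C at *
  generalize (1 / 2 : ℚ) ^ e - (1 / 2) ^ i * (1 - ((e : ℚ) - i) / 2) = E at *
  generalize (1 / 2 : ℚ) ^ i / 4 = P at *
  have ha : (a = i ∨ a = i + 1) ∨ (a = i + 2 ∧ P ≤ A) := by
    rcases a2 with h | h | h
    exacts [Or.inl h, Or.inr h, by linarith]
  have hb : (b = i ∨ b = i + 1) ∨ (b = i + 2 ∧ P ≤ B) := by
    rcases b2 with h | h | h
    exacts [Or.inl h, Or.inr h, by linarith]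
  have hc : (c = i ∨ c = i + 1) ∨ (c = i + 2 ∧ P ≤ C) := by
    rcases c2 with h | h | h
    exacts [Or.inl h, Or.inr h, by linarith]
  have he : (e = i ∨ e = i + 1) ∨ (e = i + 2 ∧ P ≤ E) := by
    rcases e2 with h | h | h
    exacts [Or.inl h, Or.inr h, by linarith]
  clear hw hq a2 b2 c2 e2
  rcases ha with ha | ⟨ha, ha'⟩
  · rcases hb with hb | ⟨hb, hb'⟩
    · rcases hc with hc | ⟨hc, hc'⟩
      · rcases he with he | ⟨he, -⟩
        · exact Or.inl ⟨ha, hb, hc, he⟩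
        · exact Or.inr (Or.inr (Or.inr (Or.inr ⟨he, by omega, by omega, by omega⟩)))
      · have he := he.resolve_right fun h => by linarith [h.2]
        exact Or.inr (Or.inr (Or.inr (Or.inl ⟨hc, by omega, by omega, by omega⟩)))
    · have hc := hc.resolve_right fun h => by linarith [h.2]
      have he := he.resolve_right fun h => by linarith [h.2]
      exact Or.inr (Or.inr (Or.inl ⟨hb, by omega, by omega, by omega⟩))
  · have hb := hb.resolve_right fun h => by linarith [h.2]
    have hc := hc.resolve_right fun h => by linarith [h.2]
    have he := he.resolve_right fun h => by linarith [h.2]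
    exact Or.inr (Or.inl ⟨ha, by omega, by omega, by omega⟩)

theorem ne_pairs_of_weight_max {f : MvPolynomial (Fin (m + 4)) ℂ} (hf : f.IsSymmetric)
    (h0 : rename (pairMap m) f = 0) {s : Fin (m + 4) →₀ ℕ} (hs : coeff s f ≠ 0)
    (hmax : ∀ s', coeff s' f ≠ 0 → weight s' ≤ weight s) :
    ¬ ((s 0 ≤ s 1 ∧ s 1 ≤ s 0 + 1) ∧ (s 2 ≤ s 3 ∧ s 3 ≤ s 2 + 1)) := by
  rintro ⟨⟨h1, h2⟩, h3, h4⟩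
  refine hs (coeff_eq_zero_of_fiber hf h0 s fun s' e0 e2 ej hne => ?_)
  have := sum_four_le_of_weight_le ej (hmax s' hne)
  obtain ⟨p1, p2⟩ := half_pow_add_le e0 h1 h2
  obtain ⟨q1, q2⟩ := half_pow_add_le e2 h3 h4
  exact ⟨p2 (by linarith), q2 (by linarith)⟩

theorem coeff_eq_zero_of_narrow {f : MvPolynomial (Fin (m + 4)) ℂ} (hf : f.IsSymmetric)
    (h0 : rename (pairMap m) f = 0) {i : ℕ} {B : Fin (m + 4) → ℕ}
    (hB : ∀ v : Fin (m + 4) →₀ ℕ, coeff v f ≠ 0 →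
      (∀ j, j ≠ 0 → j ≠ 1 → j ≠ 2 → j ≠ 3 → v j = B j) →
      (1 / 2 : ℚ) ^ v 0 + (1 / 2) ^ v 1 + (1 / 2) ^ v 2 + (1 / 2) ^ v 3 ≤
        3 * (1 / 2) ^ i + (1 / 2) ^ (i + 2))
    {u : Fin (m + 4) →₀ ℕ} (hu : ∀ j, j ≠ 0 → j ≠ 1 → j ≠ 2 → j ≠ 3 → u j = B j)
    (u0 : u 0 = i) (u1 : u 1 = i + 1) (u2 : u 2 = i) (u3 : u 3 = i + 1) :
    coeff u f = 0 := by
  refine coeff_eq_zero_of_fiber hf h0 u fun v f0 f2 fj vne => ?_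
  have hw := hB v vne fun j j0 j1 j2 j3 => (fj j j0 j1 j2 j3).trans (hu j j0 j1 j2 j3)
  rw [u0, u1] at f0
  rw [u2, u3] at f2
  rw [u0, u1, u2, u3]
  generalize v 0 = a, v 1 = b, v 2 = c, v 3 = e at *
  have hc := cases_of_half_pow_sum_le (by omega) hw
  clear hw hB
  rcases hc with ⟨l0, -, l2, -⟩ | ⟨l0, l1, -, -⟩ | ⟨l0, l1, -, -⟩ | ⟨l0, -, -, l1⟩ | ⟨l0, -, -, l1⟩
  · exact ⟨l0, l2⟩
  all_goals omega

theorem ne_triple_of_weight_max {f : MvPolynomial (Fin (m + 4)) ℂ} (hf : f.IsSymmetric)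
    (h0 : rename (pairMap m) f = 0) {s : Fin (m + 4) →₀ ℕ} (hs : coeff s f ≠ 0)
    (hmax : ∀ s', coeff s' f ≠ 0 → weight s' ≤ weight s) (i : ℕ) :
    ¬ (s 0 = i ∧ s 1 = i ∧ s 2 = i ∧ s 3 = i + 2) := by
  obtain ⟨n01, n02, n03, n12, n13, n23⟩ := fin_first_four_ne m
  rintro ⟨h1, h2, h3, h4⟩
  have hB : ∀ v : Fin (m + 4) →₀ ℕ, coeff v f ≠ 0 →
      (∀ j, j ≠ 0 → j ≠ 1 → j ≠ 2 → j ≠ 3 → v j = s j) →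
      (1 / 2 : ℚ) ^ v 0 + (1 / 2) ^ v 1 + (1 / 2) ^ v 2 + (1 / 2) ^ v 3 ≤
        3 * (1 / 2) ^ i + (1 / 2) ^ (i + 2) := by
    intro v hv hj
    have := sum_four_le_of_weight_le hj (hmax v hv)
    rw [h1, h2, h3, h4] at this
    linarith
  refine hs (coeff_eq_zero_of_fiber hf h0 s fun s' e0 e2 ej hne => ?_)
  have hw := hB s' hne ej
  rw [h1, h2] at e0
  rw [h3, h4] at e2
  rw [h1, h2, h3, h4]
  have hc := cases_of_half_pow_sum_le (by omega) hw
  clear hw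
  rcases hc with ⟨k0, k1, k2, k3⟩ | ⟨k0, k1, k2, k3⟩ | ⟨k0, k1, k2, k3⟩ | ⟨k0, k1, k2, k3⟩ |
    ⟨k0, k1, k2, k3⟩
  · exfalso
    replace k0 : s' 0 = i := by omega
    replace k1 : s' 1 = i := by omega
    replace k2 : s' 2 = i + 1 := by omega
    replace k3 : s' 3 = i + 1 := by omega
    apply hne
    rw [← coeff_mapDomain_of_isSymmetric hf (Equiv.swap 1 2)]
    have hua := mapDomain_swap_apply s' 1 2
    generalize s'.mapDomain (Equiv.swap 1 2) = u at hua ⊢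
    refine coeff_eq_zero_of_narrow hf h0 hB (fun j j0 j1 j2 j3 => ?_) ?_ ?_ ?_ ?_
    · rw [hua, if_neg j1, if_neg j2, ej j j0 j1 j2 j3]
    · rw [hua, if_neg n01, if_neg n02, k0]
    · rw [hua, if_pos rfl, k2]
    · rw [hua, if_neg n12.symm, if_pos rfl, k1]
    · rw [hua, if_neg n13.symm, if_neg n23.symm, k3]
  · omega
  · omega
  · exact ⟨Or.inl k1, Or.inr k0⟩
  · exact ⟨Or.inl k1, Or.inl k3⟩

theorem exists_mem_of_cons_le_map {α β : Type*} [DecidableEq α] {l : α → β} {v : β}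
    {P : Multiset β} {t : Finset α} (h : v ::ₘ P ≤ t.val.map l) :
    ∃ a ∈ t, l a = v ∧ P ≤ (t.erase a).val.map l := by
  obtain ⟨a, ha, rfl⟩ := Multiset.mem_map.1 (Multiset.mem_of_le h (Multiset.mem_cons_self _ _))
  refine ⟨a, ha, rfl, ?_⟩
  rwa [← Multiset.cons_erase ha, Multiset.map_cons, Multiset.cons_le_cons_iff,
    ← Finset.erase_val] at h

theorem exists_four_of_le_map {α β : Type*} [DecidableEq α] {l : α → β} {w x y z : β}
    {t : Finset α} (h : ({w, x, y, z} : Multiset β) ≤ t.val.map l) :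
    ∃ a b c e, (a ∈ t ∧ b ∈ t ∧ c ∈ t ∧ e ∈ t) ∧
      (a ≠ b ∧ a ≠ c ∧ a ≠ e ∧ b ≠ c ∧ b ≠ e ∧ c ≠ e) ∧
      l a = w ∧ l b = x ∧ l c = y ∧ l e = z := by
  obtain ⟨a, ha, ha', h1⟩ := exists_mem_of_cons_le_map h
  obtain ⟨b, hb, hb', h2⟩ := exists_mem_of_cons_le_map h1
  obtain ⟨c, hc, hc', h3⟩ := exists_mem_of_cons_le_map h2
  obtain ⟨e, he, he', -⟩ := exists_mem_of_cons_le_map (P := 0) h3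
  simp only [Finset.mem_erase] at hb hc he
  refine ⟨a, b, c, e, ?_⟩
  grind

theorem exists_perm_first_four {a b c e : Fin (m + 4)}
    (h : a ≠ b ∧ a ≠ c ∧ a ≠ e ∧ b ≠ c ∧ b ≠ e ∧ c ≠ e) :
    ∃ g : Equiv.Perm (Fin (m + 4)), g 0 = a ∧ g 1 = b ∧ g 2 = c ∧ g 3 = e := by
  obtain ⟨n01, n02, n03, n12, n13, n23⟩ := fin_first_four_ne m
  have hx : Function.Injective ![(0 : Fin (m + 4)), 1, 2, 3] := by
    intro i j hij
    fin_cases i <;> fin_cases j <;> simp_all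
  have hy : Function.Injective ![a, b, c, e] := by
    intro i j hij
    fin_cases i <;> fin_cases j <;> simp_all
  obtain ⟨g, hg⟩ := (Equiv.Perm.isMultiplyPretransitive (Fin (m + 4)) 4).exists_smul_eq
    ⟨_, hx⟩ ⟨_, hy⟩
  have := fun i => DFunLike.congr_fun hg i
  exact ⟨g, this 0, this 1, this 2, this 3⟩

/-- The exponent vector of the first `n` values of `l`. -/
noncomputable def exponentOf (n : ℕ) (l : ℕ → ℕ) : Fin n →₀ ℕ :=
  Finsupp.equivFunOnFinite.symm fun j => l j

@[simp]
theorem exponentOf_apply (n : ℕ) (l : ℕ → ℕ) (j : Fin n) : exponentOf n l j = l j := rfl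

theorem exists_perm_antitone {n : ℕ} (s : Fin n → ℕ) :
    ∃ e : Equiv.Perm (Fin n), Antitone (s ∘ e) :=
  ⟨Fin.revPerm.trans (Tuple.sort s), fun _ _ hij =>
    Tuple.monotone_sort s (Fin.rev_le_rev.2 hij)⟩

theorem exists_partition_exponentOf {n : ℕ} (s : Fin n →₀ ℕ) :
    ∃ (l : ℕ → ℕ) (e : Equiv.Perm (Fin n)), PartitionN n l ∧ exponentOf n l = s.mapDomain e := by
  obtain ⟨e, he⟩ := exists_perm_antitone s
  refine ⟨fun j => if h : j < n then s (e ⟨j, h⟩) else 0, e.symm, ⟨fun i j hij => ?_, ?_⟩, ?_⟩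
  · dsimp only
    split_ifs with h1 h2
    · exact he hij
    · omega
    · exact Nat.zero_le _
    · exact le_rfl
  · intro j hj
    exact dif_neg (by omega)
  · ext j
    rw [Finsupp.mapDomain_equiv_apply]
    simp

theorem exists_admissible_coeff_ne_zero {f : MvPolynomial (Fin (m + 4)) ℂ} (hf : f.IsSymmetric)
    (h0 : rename (pairMap m) f = 0) (hne : f ≠ 0) :
    ∃ l, PartitionN (m + 4) l ∧ Admissible (m + 4) l ∧ coeff (exponentOf (m + 4) l) f ≠ 0 := by
  obtain ⟨s₀, hs₀, hmax₀⟩ := f.support.exists_max_image weight (support_nonempty.2 hne)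
  obtain ⟨l, e, hl, hle⟩ := exists_partition_exponentOf s₀
  have key : ∀ g : Equiv.Perm (Fin (m + 4)),
      coeff ((exponentOf (m + 4) l).mapDomain g) f ≠ 0 ∧
      ∀ s', coeff s' f ≠ 0 → weight s' ≤ weight ((exponentOf (m + 4) l).mapDomain g) := by
    intro g
    rw [coeff_mapDomain_of_isSymmetric hf, weight_mapDomain, hle,
      coeff_mapDomain_of_isSymmetric hf, weight_mapDomain]
    exact ⟨mem_support_iff.1 hs₀, fun s' hs' => hmax₀ s' (mem_support_iff.2 hs')⟩
  have place : ∀ w x y z : ℕ,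
      ({w, x, y, z} : Multiset ℕ) ≤ (Finset.range (m + 4)).val.map l →
      ∃ s : Fin (m + 4) →₀ ℕ, (coeff s f ≠ 0 ∧ ∀ s', coeff s' f ≠ 0 → weight s' ≤ weight s) ∧
        s 0 = w ∧ s 1 = x ∧ s 2 = y ∧ s 3 = z := by
    intro w x y z h
    obtain ⟨a, b, c, e, ⟨ha, hb, hc, he⟩, ⟨ab, ac, ae, bc, be, ce⟩, rfl, rfl, rfl, rfl⟩ :=
      exists_four_of_le_map h
    rw [Finset.mem_range] at ha hb hc he
    obtain ⟨g, g0, g1, g2, g3⟩ := exists_perm_first_four (a := ⟨a, ha⟩) (b := ⟨b, hb⟩)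
      (c := ⟨c, hc⟩) (e := ⟨e, he⟩) (by simp [*])
    refine ⟨_, key g.symm, ?_⟩
    simp only [Finsupp.mapDomain_equiv_apply, Equiv.symm_symm, g0, g1, g2, g3, exponentOf_apply,
      and_self]
  refine ⟨l, hl, ?_, ?_⟩
  · rintro (⟨P, Q, hP, hQ, h⟩ | ⟨i, h⟩)
    · obtain ⟨i, i', hi, rfl⟩ : ∃ i i', (i ≤ i' ∧ i' ≤ i + 1) ∧ P = {i, i'} := by
        obtain ⟨i, rfl | rfl⟩ := hP
        exacts [⟨i, i, by omega, rfl⟩, ⟨i, i + 1, by omega, rfl⟩]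
      obtain ⟨j, j', hj, rfl⟩ : ∃ i i', (i ≤ i' ∧ i' ≤ i + 1) ∧ Q = {i, i'} := by
        obtain ⟨i, rfl | rfl⟩ := hQ
        exacts [⟨i, i, by omega, rfl⟩, ⟨i, i + 1, by omega, rfl⟩]
      obtain ⟨s, ⟨hs, hmax⟩, rfl, rfl, rfl, rfl⟩ := place i i' j j' h
      exact ne_pairs_of_weight_max hf h0 hs hmax ⟨hi, hj⟩
    · obtain ⟨s, ⟨hs, hmax⟩, h1, h2, h3, h4⟩ := place i i i (i + 2) h
      exact ne_triple_of_weight_max hf h0 hs hmax i ⟨h1, h2, h3, h4⟩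
  · rw [hle, coeff_mapDomain_of_isSymmetric hf]
    exact mem_support_iff.1 hs₀

end UpperBound

section LowerBound

variable {n : ℕ}

/-- The product of `X i - X j` over all ordered pairs `i ≠ j` with `t ≤ j`. -/
noncomputable def partialDisc (n t : ℕ) : MvPolynomial (Fin n) ℂ :=
  ∏ j : Fin n, ∏ i : Fin n, if t ≤ (j : ℕ) ∧ i ≠ j then X i - X j else 1

/-- Symmetrization of the monomial `X ^ a` times `partialDisc n t`. -/
noncomputable def symDisc (t : ℕ) (a : Fin n →₀ ℕ) : MvPolynomial (Fin n) ℂ :=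
  ∑ e : Equiv.Perm (Fin n), rename e (monomial a 1 * partialDisc n t)

theorem symDisc_isSymmetric (t : ℕ) (a : Fin n →₀ ℕ) : (symDisc t a).IsSymmetric := by
  intro g
  simp only [symDisc, map_sum, rename_rename]
  exact Equiv.sum_comp (Equiv.mulLeft g) fun e : Equiv.Perm (Fin n) =>
    rename e (monomial a 1 * partialDisc n t)

theorem partialDisc_isHomogeneous (t : ℕ) :
    (partialDisc n t).IsHomogeneous ((n - t) * (n - 1)) := by
  have h : (partialDisc n t).IsHomogeneous
      (∑ j : Fin n, ∑ i : Fin n, if t ≤ (j : ℕ) ∧ i ≠ j then 1 else 0) := by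
    refine IsHomogeneous.prod _ _ _ fun j _ => IsHomogeneous.prod _ _ _ fun i _ => ?_
    split_ifs
    · exact (isHomogeneous_X _ _).sub (isHomogeneous_X _ _)
    · exact isHomogeneous_one _ _
  convert h
  have : ∀ j : Fin n, (∑ i : Fin n, if t ≤ (j : ℕ) ∧ i ≠ j then 1 else 0) =
      if t ≤ (j : ℕ) then n - 1 else 0 := by
    intro j
    by_cases hj : t ≤ (j : ℕ)
    · simp only [hj, true_and, ite_true]
      rw [← Finset.sum_filter, Finset.filter_ne', Finset.sum_const, Finset.card_erase_of_mem
        (Finset.mem_univ j), Finset.card_univ, Fintype.card_fin, smul_eq_mul, mul_one]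
    · simp [hj]
  simp only [this]
  rw [← Finset.sum_filter, Finset.sum_const, smul_eq_mul]
  congr 1
  rw [Finset.card_filter, Fin.sum_univ_eq_sum_range (fun j => if t ≤ j then 1 else 0),
    ← Finset.card_filter, ← Nat.card_Ico]
  congr 1
  ext j
  simp [and_comm]

theorem symDisc_isHomogeneous {t d : ℕ} {a : Fin n →₀ ℕ}
    (hd : ∑ j, a j + (n - t) * (n - 1) = d) : (symDisc t a).IsHomogeneous d := by
  subst hd
  refine IsHomogeneous.sum _ _ _ fun e _ => IsHomogeneous.rename_isHomogeneous ?_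
  refine (isHomogeneous_monomial _ ?_).mul (partialDisc_isHomogeneous t)
  rw [Finsupp.degree_eq_sum]

theorem rename_partialDisc_eq_zero {t : ℕ} {g : Fin n → Fin n} {e : Equiv.Perm (Fin n)}
    {a b : Fin n} (hab : a ≠ b) (hg : g a = g b) (h : t ≤ (e.symm a : ℕ) ∨ t ≤ (e.symm b : ℕ)) :
    rename g (rename e (partialDisc n t)) = 0 := by
  wlog hb : t ≤ (e.symm b : ℕ) generalizing a b
  · exact this hab.symm hg.symm h.symm (h.resolve_right hb)
  simp only [partialDisc, map_prod]
  refine Finset.prod_eq_zero (Finset.mem_univ (e.symm b))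
    (Finset.prod_eq_zero (Finset.mem_univ (e.symm a)) ?_)
  rw [if_pos ⟨hb, by simpa using hab⟩]
  simp [hg]

theorem rename_symDisc_eq_zero {t : ℕ} {g : Fin n → Fin n} {a : Fin n →₀ ℕ}
    (h : ∀ e : Equiv.Perm (Fin n), ∃ i j, i ≠ j ∧ g i = g j ∧ t ≤ (e i : ℕ)) :
    rename g (symDisc t a) = 0 := by
  rw [symDisc, map_sum]
  refine Finset.sum_eq_zero fun e _ => ?_
  obtain ⟨i, j, hij, hg, hi⟩ := h e.symm
  rw [map_mul, map_mul, rename_partialDisc_eq_zero hij hg (Or.inl hi), mul_zero]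

theorem rename_pairMap_symDisc {m t : ℕ} (ht : t ≤ 3) (a : Fin (m + 4) →₀ ℕ) :
    rename (pairMap m) (symDisc t a) = 0 := by
  obtain ⟨n01, n02, n03, n12, n13, n23⟩ := fin_first_four_ne m
  refine rename_symDisc_eq_zero fun e => ?_
  have h01 : pairMap m 0 = pairMap m 1 := by simp [pairMap, n01, n03]
  have h23 : pairMap m 2 = pairMap m 3 := by
    simp [pairMap, n12.symm, n23, n13.symm]
  by_contra! h
  have e0 := h 0 1 n01 h01
  have e1 := h 1 0 n01.symm h01.symm
  have e2 := h 2 3 n23 h23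
  have e3 := h 3 2 n23.symm h23.symm
  have := fun {i j} => (e.injective.ne_iff (x := i) (y := j)).2
  have f01 := this n01
  have f02 := this n02
  have f03 := this n03
  have f12 := this n12
  have f13 := this n13
  have f23 := this n23
  rw [Ne, Fin.ext_iff] at f01 f02 f03 f12 f13 f23
  omega

/-- The substitution of indices sending all `i < t` to `0`. -/
def collapse (m t : ℕ) (i : Fin (m + 4)) : Fin (m + 4) := if (i : ℕ) < t then 0 else i

theorem rename_collapse_symDisc_eq_zero {m t t' : ℕ} (ht' : t' = 2 ∨ t' = 3) (h : t < t')
    (ht : t = 0 ∨ t = 2) (a : Fin (m + 4) →₀ ℕ) : rename (collapse m t') (symDisc t a) = 0 := by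
  obtain ⟨n01, n02, n03, n12, n13, n23⟩ := fin_first_four_ne m
  refine rename_symDisc_eq_zero fun e => ?_
  have c0 : collapse m t' 0 = 0 := ite_self _
  have c1 : collapse m t' 1 = 0 := if_pos (by rw [Fin.val_one]; omega)
  by_contra! h
  have e0 := h 0 1 n01 (c0.trans c1.symm)
  have e1 := h 1 0 n01.symm (c1.trans c0.symm)
  obtain rfl | rfl := ht
  · omega
  obtain rfl : t' = 3 := by omega
  have c2 : collapse m 3 2 = 0 := by
    have h2 : 2 % (m + 4) = 2 := Nat.mod_eq_of_lt (by omega)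
    simp [collapse, h2]
  have e2 := h 2 0 n02.symm (c2.trans c0.symm)
  have := fun {i j} => (e.injective.ne_iff (x := i) (y := j)).2
  have f01 := this n01
  have f02 := this n02
  have f12 := this n12
  rw [Ne, Fin.ext_iff] at f01 f02 f12
  omega

theorem rename_partialDisc_of_stable {t : ℕ} {e : Equiv.Perm (Fin n)}
    (he : ∀ i, t ≤ (e i : ℕ) ↔ t ≤ (i : ℕ)) :
    rename e (partialDisc n t) = partialDisc n t := by
  simp only [partialDisc, map_prod]
  conv_rhs => rw [← Equiv.prod_comp e]
  refine Finset.prod_congr rfl fun j _ => ?_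
  conv_rhs => rw [← Equiv.prod_comp e]
  refine Finset.prod_congr rfl fun i _ => ?_
  simp only [he, e.injective.ne_iff]
  split_ifs <;> simp

theorem rename_collapse_partialDisc_ne_zero (m t : ℕ) :
    rename (collapse m t) (partialDisc (m + 4) t) ≠ 0 := by
  simp only [partialDisc, map_prod]
  refine Finset.prod_ne_zero_iff.2 fun j _ => Finset.prod_ne_zero_iff.2 fun i _ => ?_
  split_ifs with h
  · rw [map_sub, rename_X, rename_X, sub_ne_zero]
    refine (X_injective).ne ?_
    rw [collapse, collapse, if_neg (not_lt.2 h.1)]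
    split_ifs with hi
    · rintro rfl
      simp at h
      omega
    · exact h.2
  · simp

/-- The permutations preserving the set of indices `≥ t`. -/
noncomputable def stablePerms (n t : ℕ) : Finset (Equiv.Perm (Fin n)) := by
  classical exact Finset.univ.filter fun e => ∀ i, t ≤ (e i : ℕ) ↔ t ≤ (i : ℕ)

theorem mem_stablePerms {t : ℕ} {e : Equiv.Perm (Fin n)} :
    e ∈ stablePerms n t ↔ ∀ i, t ≤ (e i : ℕ) ↔ t ≤ (i : ℕ) := by
  simp [stablePerms]

theorem stable_of_symm_lt {t : ℕ} {e : Equiv.Perm (Fin n)}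
    (h : ∀ i : Fin n, (i : ℕ) < t → (e.symm i : ℕ) < t) :
    e ∈ stablePerms n t := by
  rw [mem_stablePerms]
  have key : ∀ i : Fin n, (i : ℕ) < t ↔ (e i : ℕ) < t := by
    refine fun i => ⟨fun hi => ?_, fun hi => by simpa using h _ hi⟩
    exact Equiv.Perm.perm_symm_on_of_perm_on_finite (f := e.symm)
      (p := fun i : Fin n => (i : ℕ) < t) h hi
  exact fun i => by simpa using (not_congr (key i)).symm

theorem rename_collapse_symDisc {m t : ℕ} (ht : t = 0 ∨ t = 2 ∨ t = 3) (a : Fin (m + 4) →₀ ℕ) :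
    rename (collapse m t) (symDisc t a) =
      (∑ e ∈ stablePerms (m + 4) t, monomial ((a.mapDomain e).mapDomain (collapse m t)) 1) *
        rename (collapse m t) (partialDisc (m + 4) t) := by
  rw [symDisc, map_sum, Finset.sum_mul,
    ← Finset.sum_subset (Finset.subset_univ (stablePerms (m + 4) t))]
  · refine Finset.sum_congr rfl fun e he => ?_
    rw [map_mul, rename_partialDisc_of_stable (mem_stablePerms.1 he), map_mul, rename_monomial,
      rename_monomial]
  · intro e _ he
    by_contra hne
    refine he (stable_of_symm_lt fun i hi => ?_)
    by_contra! hi'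
    refine hne ?_
    obtain ⟨j, hij, hj⟩ : ∃ j, i ≠ j ∧ collapse m t i = collapse m t j := by
      have h1 : ((1 : Fin (m + 4)) : ℕ) = 1 := Fin.val_one _
      have c0 : collapse m t 0 = 0 := ite_self _
      have c1 : collapse m t 1 = 0 := if_pos (by omega)
      have ci : collapse m t i = 0 := if_pos hi
      by_cases h0 : i = 0
      · exact ⟨1, by rw [h0]; simp, by rw [ci, c1]⟩
      · exact ⟨0, h0, by rw [ci, c0]⟩
    rw [map_mul, map_mul, rename_partialDisc_eq_zero hij hj (Or.inl hi'), mul_zero]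

/-- Normal forms of exponents: zero at the indices `0 < i < t`, antitone on the indices `≥ t`. -/
def IsNormal (t : ℕ) (a : Fin n →₀ ℕ) : Prop :=
  (∀ i : Fin n, 0 < (i : ℕ) → (i : ℕ) < t → a i = 0) ∧
    ∀ i j : Fin n, t ≤ (i : ℕ) → i ≤ j → a j ≤ a i

theorem eq_of_antitone_comp_perm {f g : Fin n → ℕ} (hf : Antitone f) (hg : Antitone g)
    (e : Equiv.Perm (Fin n)) (h : f ∘ e = g) : f = g := by
  have := Tuple.unique_antitone (f := f) (σ := Equiv.refl _) (τ := e) hf (h ▸ hg)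
  rw [← h, ← this]
  rfl

theorem IsNormal.eq_of_mapDomain {m t : ℕ} {a b : Fin (m + 4) →₀ ℕ} (ha : IsNormal t a)
    (hb : IsNormal t b) {e : Equiv.Perm (Fin (m + 4))} (he : e ∈ stablePerms (m + 4) t)
    (h : (a.mapDomain e).mapDomain (collapse m t) = b.mapDomain (collapse m t)) : a = b := by
  rw [mem_stablePerms] at he
  have hes : ∀ i, t ≤ (e.symm i : ℕ) ↔ t ≤ (i : ℕ) := fun i => by
    rw [← he, Equiv.apply_symm_apply]
  have hge : ∀ (c : Fin (m + 4) →₀ ℕ) (j : Fin (m + 4)), t ≤ (j : ℕ) →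
      c.mapDomain (collapse m t) j = c j := by
    intro c j hj
    rw [Finsupp.mapDomain, Finsupp.sum_fintype _ _ (by simp), Finsupp.finsetSum_apply,
      Finset.sum_eq_single j]
    · simp [collapse, not_lt.2 hj]
    · intro i _ hij
      rw [Finsupp.single_apply, if_neg]
      rw [collapse]
      split_ifs with hi
      · rintro rfl
        simp at hj
        omega
      · exact hij
    · simp
  have hab : ∀ j : Fin (m + 4), t ≤ (j : ℕ) → a (e.symm j) = b j := fun j hj => by
    rw [← hge b j hj, ← h, hge _ j hj, Finsupp.mapDomain_equiv_apply]
  have hdeg : a.degree = b.degree := by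
    have := congrArg Finsupp.degree h
    simpa only [Finsupp.degree_mapDomain] using this
  have hle : ∀ (c : Fin (m + 4) →₀ ℕ) i, c i ≤ c.degree := fun c i => Finsupp.le_degree i c
  have hanti : ∀ c : Fin (m + 4) →₀ ℕ, IsNormal t c → c.degree = b.degree →
      Antitone fun i : Fin (m + 4) => if (i : ℕ) < t then b.degree else c i := by
    intro c hc hcd i j hij
    have hij' : (i : ℕ) ≤ j := hij
    dsimp only
    split_ifs with h1 h2 h2
    · rfl
    · omega
    · exact hcd ▸ hle c j
    · exact hc.2 i j (not_lt.1 h2) hij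
  have heq := eq_of_antitone_comp_perm (hanti a ha hdeg) (hanti b hb rfl) e.symm (by
    funext j
    have := hes j
    dsimp only [Function.comp]
    split_ifs with h1 h2 h2
    · rfl
    · omega
    · omega
    · exact hab j (not_lt.1 h2))
  have hne : ∀ j : Fin (m + 4), j ≠ 0 → a j = b j := by
    intro j hj
    by_cases hjt : (j : ℕ) < t
    · have hj0 : 0 < (j : ℕ) := Nat.pos_of_ne_zero fun h => hj (Fin.ext h)
      rw [ha.1 j hj0 hjt, hb.1 j hj0 hjt]
    · simpa [hjt] using congrFun heq j
  ext j
  by_cases hj : j = 0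
  · subst hj
    rw [Finsupp.degree_eq_sum, Finsupp.degree_eq_sum, ← Finset.add_sum_erase _ _ (mem_univ 0),
      ← Finset.add_sum_erase _ b (mem_univ 0),
      Finset.sum_congr rfl fun j hj => hne j (Finset.ne_of_mem_erase hj)] at hdeg
    exact Nat.add_right_cancel hdeg
  · exact hne j hj

theorem sum_smul_symDisc_eq_zero {m t : ℕ} (ht : t = 0 ∨ t = 2 ∨ t = 3) {ι : Type*}
    (s : Finset ι) (a : ι → Fin (m + 4) →₀ ℕ) (ha : ∀ i ∈ s, IsNormal t (a i))
    (hinj : Set.InjOn a s) (c : ι → ℂ)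
    (h : rename (collapse m t) (∑ i ∈ s, c i • symDisc t (a i)) = 0) :
    ∀ i ∈ s, c i = 0 := by
  classical
  intro i hi
  simp only [map_sum, map_smul, rename_collapse_symDisc ht, ← smul_mul_assoc] at h
  rw [← Finset.sum_mul, mul_eq_zero, or_iff_left (rename_collapse_partialDisc_ne_zero m t)] at h
  have hc := congrArg (coeff ((a i).mapDomain (collapse m t))) h
  simp only [coeff_sum, coeff_smul, coeff_monomial, coeff_zero] at hc
  rw [Finset.sum_eq_single_of_mem i hi] at hc
  · rw [Finset.sum_boole, smul_eq_mul, mul_eq_zero, Nat.cast_eq_zero, Finset.card_eq_zero] at hc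
    refine hc.resolve_right (Finset.Nonempty.ne_empty ⟨1, ?_⟩)
    simp [mem_stablePerms, Equiv.Perm.coe_one]
  · intro j hj hji
    rw [Finset.sum_eq_zero, smul_zero]
    intro e he
    rw [if_neg]
    exact fun h => hji (hinj hj hi ((ha j hj).eq_of_mapDomain (ha i hi) he h))

end LowerBound

section Encoding

variable {n t p c : ℕ} {l : ℕ → ℕ}

theorem add_two_mul_le_of_gaps {a b : ℕ} (h : ∀ k, a ≤ k → k + 1 < b → l (k + 1) + 2 ≤ l k)
    {i : ℕ} (hi : a ≤ i) (q : ℕ) (hq : i + q < b) : l (i + q) + 2 * q ≤ l i := by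
  induction q with
  | zero => simp
  | succ q ih =>
    have h1 := ih (by omega)
    have h2 := h (i + q) (by omega) (by omega)
    rw [← add_assoc]
    omega

/-- The parts `l p, …, l (p + t - 1)` form a cluster of nearly equal parts with reference value `c`,
and all the other parts are separated from each other and from the cluster. -/
structure Clustered (n t p c : ℕ) (l : ℕ → ℕ) : Prop where
  add_le : p + t ≤ n
  cluster : t = 0 ∧ p = 0 ∨ t = 2 ∧ l p = c ∧ l (p + 1) ≤ c ∧ c ≤ l (p + 1) + 1 ∨
    t = 3 ∧ l (p + 2) = c ∧ c ≤ l (p + 1) ∧ l (p + 1) ≤ l p ∧ l p ≤ c + 1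
  gap_above : ∀ k, k + 1 < p → l (k + 1) + 2 ≤ l k
  gap_below : ∀ k, p + t ≤ k → k + 1 < n → l (k + 1) + 2 ≤ l k
  cluster_le : ∀ k, k + 1 = p → c + t ≤ l k
  le_cluster : p + t < n → l (p + t) + 2 ≤ c

/-- The exponent of the symmetrized generator attached to a clustered partition. -/
def clusterCode (n t p : ℕ) (l : ℕ → ℕ) (j : ℕ) : ℕ :=
  if j < t then if j = 0 then ∑ i ∈ range t, l (p + i) - t * (n - t - p) else 0
  else if j < t + p then l (j - t) - (t + 2 * (n - 1 - j))
  else l j - 2 * (n - 1 - j)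

namespace Clustered

theorem below_le (h : Clustered n t p c l) {k : ℕ} (hk : p + t ≤ k) (hkn : k < n) :
    2 * (n - 1 - k) ≤ l k := by
  have := add_two_mul_le_of_gaps h.gap_below hk (n - 1 - k) (by omega)
  omega

theorem le_ref (h : Clustered n t p c l) : 2 * (n - t - p) ≤ c := by
  by_cases hpn : p + t < n
  · have h1 := h.le_cluster hpn
    have h2 := h.below_le le_rfl hpn
    omega
  · omega

theorem above_le (h : Clustered n t p c l) {k : ℕ} (hk : k < p) :
    t + 2 * (n - 1 - (t + k)) ≤ l k := by
  have h1 := h.le_ref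
  have h2 := add_two_mul_le_of_gaps (a := 0) (fun k _ => h.gap_above k) (Nat.zero_le k)
    (p - 1 - k) (by omega)
  have h3 := h.cluster_le (p - 1) (by omega)
  have h4 : k + (p - 1 - k) = p - 1 := by omega
  rw [h4] at h2
  have := h.add_le
  omega

theorem sum_le (h : Clustered n t p c l) :
    t * (n - t - p) ≤ ∑ i ∈ range t, l (p + i) := by
  have h1 := h.le_ref
  have h2 := h.cluster
  obtain ⟨rfl, -⟩ | ⟨rfl, h2⟩ | ⟨rfl, h2⟩ := h2
  · simp
  · simp only [sum_range_succ, sum_range_zero, add_zero]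
    omega
  · simp only [sum_range_succ, sum_range_zero, add_zero]
    omega

end Clustered

theorem sum_two_mul_reflect (m : ℕ) : ∑ k ∈ range m, 2 * (m - 1 - k) = m * (m - 1) := by
  rw [← mul_sum, sum_range_reflect (fun k => k), mul_comm, sum_range_id_mul_two]

namespace Clustered

theorem sum_clusterCode (h : Clustered n t p c l) :
    ∑ j ∈ range n, clusterCode n t p l j + (n - t) * (n - 1) = ∑ j ∈ range n, l j := by
  obtain ⟨m, rfl⟩ := Nat.exists_eq_add_of_le h.add_le
  have e1 : ∑ j ∈ range t, clusterCode (p + t + m) t p l j + t * m =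
      ∑ i ∈ range t, l (p + i) := by
    have h1 := h.sum_le
    rw [show p + t + m - t - p = m by omega] at h1
    cases t with
    | zero => simp
    | succ t =>
      rw [sum_range_succ', sum_eq_zero, zero_add, clusterCode, if_pos (by omega), if_pos rfl,
        show p + (t + 1) + m - (t + 1) - p = m by omega]
      · omega
      · intro i hi
        rw [mem_range] at hi
        rw [clusterCode, if_pos (by omega), if_neg (by omega)]
  have e2 : ∑ k ∈ range p, clusterCode (p + t + m) t p l (t + k) +
      ∑ k ∈ range p, (t + 2 * (p + m - 1 - k)) = ∑ k ∈ range p, l k := by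
    rw [← sum_add_distrib]
    refine sum_congr rfl fun k hk => ?_
    rw [mem_range] at hk
    have := h.above_le hk
    rw [clusterCode, if_neg (by omega), if_pos (by omega), Nat.add_sub_cancel_left]
    omega
  have e3 : ∑ k ∈ range m, clusterCode (p + t + m) t p l (p + t + k) +
      ∑ k ∈ range m, 2 * (m - 1 - k) = ∑ k ∈ range m, l (p + t + k) := by
    rw [← sum_add_distrib]
    refine sum_congr rfl fun k hk => ?_
    rw [mem_range] at hk
    have := h.below_le (k := p + t + k) (by omega) (by omega)
    rw [clusterCode, if_neg (by omega), if_neg (by omega)]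
    omega
  have e4 : ∑ k ∈ range p, 2 * (p + m - 1 - k) + ∑ k ∈ range m, 2 * (m - 1 - k) =
      (p + m) * (p + m - 1) := by
    rw [← sum_two_mul_reflect (p + m), sum_range_add]
    congr 1
    refine sum_congr rfl fun k _ => ?_
    omega
  rw [sum_add_distrib, sum_const, card_range, smul_eq_mul] at e2
  have e5 : (p + t + m - t) * (p + t + m - 1) = p * t + t * m + (p + m) * (p + m - 1) := by
    rw [show p + t + m - t = p + m by omega]
    obtain h0 | h0 := Nat.eq_zero_or_pos (p + m)
    · obtain ⟨rfl, rfl⟩ : p = 0 ∧ m = 0 := by omega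
      simp
    · rw [show p + t + m - 1 = t + (p + m - 1) by omega]
      ring
  have e6 : ∑ j ∈ range (p + t + m), clusterCode (p + t + m) t p l j =
      ∑ j ∈ range t, clusterCode (p + t + m) t p l j +
      ∑ k ∈ range p, clusterCode (p + t + m) t p l (t + k) +
      ∑ k ∈ range m, clusterCode (p + t + m) t p l (p + t + k) := by
    rw [sum_range_add, add_comm p t, sum_range_add _ t p]
  rw [e5, e6, ← e4, sum_range_add l, sum_range_add l, ← e1, ← e2, ← e3]
  ring

theorem clusterCode_normal (h : Clustered n t p c l) {i j : ℕ} (hi : t ≤ i)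
    (hij : i ≤ j) (hj : j < n) : clusterCode n t p l j ≤ clusterCode n t p l i := by
  induction j, hij using Nat.le_induction with
  | base => rfl
  | succ j hij ih =>
    refine le_trans ?_ (ih (by omega))
    rw [clusterCode, clusterCode, if_neg (show ¬ j + 1 < t by omega),
      if_neg (show ¬ j < t by omega)]
    split_ifs with h1 h2 h2
    · have := h.gap_above (j - t) (by omega)
      rw [show j + 1 - t = j - t + 1 by omega]
      omega
    · omega
    · have h3 := h.cluster_le (j - t) (by omega)
      have h4 := h.le_cluster (by omega)
      rw [show j + 1 = p + t by omega]
      omega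
    · have := h.gap_below j (by omega) (by omega)
      omega

theorem le_of_clusterCode_eq {p' c' : ℕ} {l' : ℕ → ℕ} (h : Clustered n t p c l)
    (h' : Clustered n t p' c' l')
    (heq : ∀ j < n, clusterCode n t p l j = clusterCode n t p' l' j) : p' ≤ p := by
  by_contra! hp
  have hn := h'.add_le
  have hc : c' + (p' - p) = c := by
    have h0 := heq 0 (by omega)
    have s1 := h.sum_le
    have s2 := h'.sum_le
    have k1 := h.cluster
    have k2 := h'.cluster
    have ht : t = 2 ∨ t = 3 := by omega
    rw [clusterCode, clusterCode, if_pos (by omega), if_pos rfl, if_pos (by omega),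
      if_pos rfl] at h0
    obtain rfl | rfl := ht <;>
    · simp only [sum_range_succ, sum_range_zero, add_zero] at h0 s1 s2
      omega
  have h1 := h'.cluster_le (p' - 1) (by omega)
  have h2 := heq (t + p' - 1) (by omega)
  rw [clusterCode, clusterCode, if_neg (by omega), if_neg (by omega), if_neg (by omega),
    if_pos (by omega), show t + p' - 1 - t = p' - 1 by omega] at h2
  have h3 := h'.above_le (k := p' - 1) (by omega)
  have h4 := h.below_le (k := t + p' - 1) (by omega) (by omega)
  have h5 := add_two_mul_le_of_gaps h.gap_below le_rfl (p' - 1 - p) (by omega)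
  rw [show p + t + (p' - 1 - p) = t + p' - 1 by omega] at h5
  have h6 := h.le_cluster (by omega)
  omega

theorem eq_of_clusterCode_eq {p' c' : ℕ} {l' : ℕ → ℕ} (h : Clustered n t p c l)
    (h' : Clustered n t p' c' l') (hl : ∀ j, n ≤ j → l j = 0) (hl' : ∀ j, n ≤ j → l' j = 0)
    (heq : ∀ j < n, clusterCode n t p l j = clusterCode n t p' l' j) : l = l' := by
  obtain rfl : p = p' := le_antisymm (h'.le_of_clusterCode_eq h fun j hj => (heq j hj).symm)
    (h.le_of_clusterCode_eq h' heq)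
  have hn := h.add_le
  funext j
  by_cases hjn : n ≤ j
  · rw [hl j hjn, hl' j hjn]
  by_cases hjp : j < p
  · have h1 := heq (t + j) (by omega)
    have h2 := h.above_le hjp
    have h3 := h'.above_le hjp
    rw [clusterCode, clusterCode, if_neg (by omega), if_pos (by omega), if_neg (by omega),
      if_pos (by omega), Nat.add_sub_cancel_left] at h1
    omega
  by_cases hjt : p + t ≤ j
  · have h1 := heq j (by omega)
    have h2 := h.below_le hjt (by omega)
    have h3 := h'.below_le hjt (by omega)
    rw [clusterCode, clusterCode, if_neg (by omega), if_neg (by omega), if_neg (by omega),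
      if_neg (by omega)] at h1
    omega
  have h0 := heq 0 (by omega)
  have s1 := h.sum_le
  have s2 := h'.sum_le
  have k1 := h.cluster
  have k2 := h'.cluster
  have ht : t = 2 ∨ t = 3 := by omega
  rw [clusterCode, clusterCode, if_pos (by omega), if_pos rfl, if_pos (by omega),
    if_pos rfl] at h0
  obtain ⟨q, rfl⟩ : ∃ q, j = p + q := Nat.exists_eq_add_of_le (by omega)
  obtain rfl | rfl := ht
  · simp only [sum_range_succ, sum_range_zero, add_zero] at h0 s1 s2
    obtain rfl | rfl : q = 0 ∨ q = 1 := by omega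
    · rw [add_zero]
      omega
    · omega
  · simp only [sum_range_succ, sum_range_zero, add_zero] at h0 s1 s2
    obtain rfl | rfl | rfl : q = 0 ∨ q = 1 ∨ q = 2 := by omega
    · rw [add_zero]
      omega
    · omega
    · omega

end Clustered

theorem goodPair_of_le {a b : ℕ} (h : b ≤ a) (h' : a ≤ b + 1) : GoodPair {b, a} := by
  refine ⟨b, ?_⟩
  obtain rfl | rfl : a = b ∨ a = b + 1 := by omega
  · exact Or.inl rfl
  · exact Or.inr rfl

theorem Admissible.gap_of_gap (h : Admissible n l) (hl : Antitone l) {j k : ℕ} (hjk : j + 2 ≤ k)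
    (hk : k + 1 < n) (hj : l j ≤ l (j + 1) + 1) : l (k + 1) + 2 ≤ l k := by
  by_contra! hlt
  refine h (Or.inl ⟨_, _, goodPair_of_le (hl (Nat.le_succ j)) hj,
    goodPair_of_le (b := l (k + 1)) (hl (Nat.le_succ k)) (by omega), ?_⟩)
  have hle : ({j + 1, j, k + 1, k} : Multiset ℕ) ≤ (range n).val := by
    rw [Multiset.le_iff_subset (by simp; omega)]
    intro x hx
    simp only [Multiset.insert_eq_cons, Multiset.mem_cons, Multiset.mem_singleton] at hx
    rw [mem_val, mem_range]
    omega
  exact Multiset.map_le_map hle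

theorem Admissible.not_triple (h : Admissible n l) {k : ℕ} (hk : k + 3 < n)
    (h1 : l (k + 2) = l (k + 1)) (h2 : l (k + 3) = l (k + 1)) : l k ≠ l (k + 1) + 2 := by
  intro h3
  refine h (Or.inr ⟨l (k + 1), ?_⟩)
  have hle : ({k + 1, k + 2, k + 3, k} : Multiset ℕ) ≤ (range n).val := by
    rw [Multiset.le_iff_subset (by simp)]
    intro x hx
    simp only [Multiset.insert_eq_cons, Multiset.mem_cons, Multiset.mem_singleton] at hx
    rw [mem_val, mem_range]
    omega
  simpa [h1, h2, h3] using Multiset.map_le_map (f := l) hle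

theorem Admissible.exists_clustered (h : Admissible n l) (hl : Antitone l) :
    ∃ t p c, Clustered n t p c l := by
  classical
  by_cases hex : ∃ j, j + 1 < n ∧ l j ≤ l (j + 1) + 1
  swap
  · push Not at hex
    exact ⟨0, 0, l 0 + 2, Nat.zero_le _, Or.inl ⟨rfl, rfl⟩, by omega,
      fun k _ hk => hex k hk, by omega, fun _ => le_rfl⟩
  obtain ⟨hpn, hp⟩ := Nat.find_spec hex
  have hmin : ∀ k, k < Nat.find hex → l (k + 1) + 2 ≤ l k := fun k hk => by
    have := Nat.find_min hex hk
    omega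
  generalize Nat.find hex = p at *
  have hbelow : ∀ k, p + 2 ≤ k → k + 1 < n → l (k + 1) + 2 ≤ l k :=
    fun k hk hkn => h.gap_of_gap hl hk hkn hp
  have m1 : l (p + 1) ≤ l p := hl (Nat.le_succ p)
  have m2 : l (p + 2) ≤ l (p + 1) := hl (Nat.le_succ (p + 1))
  by_cases h3 : p + 2 < n ∧ l (p + 1) ≤ l (p + 2) + 1 ∧ l p ≤ l (p + 2) + 1
  · refine ⟨3, p, l (p + 2), by omega, Or.inr (Or.inr ⟨rfl, rfl, m2, m1, h3.2.2⟩),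
      fun k hk => hmin k (by omega), fun k hk => hbelow k (by omega), ?_,
      fun hn => hbelow (p + 2) le_rfl hn⟩
    rintro k rfl
    have g := hmin k (by omega)
    have := h.not_triple (k := k) (by omega)
    simp only [add_assoc, Nat.reduceAdd] at *
    omega
  · refine ⟨2, p, l p, by omega, Or.inr (Or.inl ⟨rfl, rfl, m1, hp⟩),
      fun k hk => hmin k (by omega), hbelow, ?_, fun hn => ?_⟩
    · rintro k rfl
      exact hmin k (by omega)
    · omega

end Encoding

section Assembly

theorem linearIndependent_symDisc {m : ℕ} {ι : Type*} [Finite ι] (t : ι → ℕ)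
    (a : ι → Fin (m + 4) →₀ ℕ) (ht : ∀ i, t i = 0 ∨ t i = 2 ∨ t i = 3)
    (ha : ∀ i, IsNormal (t i) (a i)) (hinj : ∀ i j, t i = t j → a i = a j → i = j) :
    LinearIndependent ℂ fun i => symDisc (t i) (a i) := by
  classical
  have := Fintype.ofFinite ι
  rw [Fintype.linearIndependent_iff]
  intro c hc
  have step : ∀ s, (s = 0 ∨ s = 2 ∨ s = 3) → (∀ i, s < t i → c i = 0) →
      ∀ i, t i = s → c i = 0 := by
    intro s hs hlt i hi
    refine sum_smul_symDisc_eq_zero hs (univ.filter fun i => t i = s) a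
      (fun j hj => ?_) (fun j hj k hk hjk => ?_) c ?_ i (by simpa using hi)
    · rw [← (mem_filter.1 hj).2]
      exact ha j
    · simp only [coe_filter, mem_univ, true_and, Set.mem_ofPred_eq] at hj hk
      exact hinj j k (hj.trans hk.symm) hjk
    · rw [← map_zero (rename (collapse m s)), ← hc, map_sum, map_sum, sum_filter]
      refine sum_congr rfl fun j _ => ?_
      split_ifs with hj
      · rw [hj]
      · rw [map_smul]
        obtain h | h := Nat.lt_or_gt_of_ne hj
        · rw [rename_collapse_symDisc_eq_zero (by omega) h (by have := ht j; omega), smul_zero]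
        · rw [hlt j h, zero_smul]
  have h3 := step 3 (by omega) fun i hi => by have := ht i; omega
  have h2 := step 2 (by omega) fun i hi => h3 i (by have := ht i; omega)
  have h0 := step 0 (by omega) fun i hi => by
    obtain h | h | h := ht i
    · omega
    · exact h2 i h
    · exact h3 i h
  intro i
  obtain h | h | h := ht i
  · exact h0 i h
  · exact h2 i h
  · exact h3 i h

/-- The admissible partitions of `d` with `n` parts. -/
def admSet (n d : ℕ) : Set (ℕ → ℕ) :=
  {l | PartitionN n l ∧ (∑ j ∈ range n, l j) = d ∧ Admissible n l}

theorem finite_admSet (n d : ℕ) : (admSet n d).Finite := by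
  have hinj : Set.InjOn (fun (l : ℕ → ℕ) (j : Fin n) => l j) (admSet n d) := by
    intro l hl l' hl' h
    funext j
    by_cases hj : j < n
    · exact congrFun h ⟨j, hj⟩
    · rw [hl.1.2 j (by omega), hl'.1.2 j (by omega)]
  refine Set.Finite.of_finite_image ?_ hinj
  refine (Set.finite_Iic fun _ : Fin n => d).subset ?_
  rintro _ ⟨l, hl, rfl⟩ j
  exact hl.2.1 ▸ single_le_sum (f := l) (fun _ _ => Nat.zero_le _) (mem_range.2 j.2)

theorem mem_IComponent {m d : ℕ} {f : MvPolynomial (Fin (m + 4)) ℂ} (hn : 4 ≤ m + 4) :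
    f ∈ IComponent (m + 4) hn d ↔
      f.IsSymmetric ∧ rename (pairMap m) f = 0 ∧ f.IsHomogeneous d := by
  have hsub : (aeval (R := ℂ) fun i : Fin (m + 4) =>
      if (i : ℕ) = 1 then X (⟨0, by omega⟩ : Fin (m + 4))
        else if (i : ℕ) = 3 then X (⟨2, by omega⟩ : Fin (m + 4))
        else (X i : MvPolynomial (Fin (m + 4)) ℂ)) = rename (pairMap m) := by
    have h1 : ∀ i : Fin (m + 4), i = 1 ↔ (i : ℕ) = 1 := fun i => by
      rw [Fin.ext_iff, Fin.val_one]
    have h3 : ∀ i : Fin (m + 4), i = 3 ↔ (i : ℕ) = 3 := fun i => by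
      rw [Fin.ext_iff, Fin.coe_ofNat_eq_mod, Nat.mod_eq_of_lt (by omega)]
    refine algHom_ext fun i => ?_
    rw [aeval_X, rename_X, pairMap]
    simp only [h1, h3]
    split_ifs
    · rfl
    · congr 1
    · rfl
  rw [IComponent, hsub]
  simp [and_assoc, mem_symmetricSubalgebra]

theorem isNormal_clusterCode {n t p c : ℕ} {l : ℕ → ℕ} (h : Clustered n t p c l) :
    IsNormal t (exponentOf n (clusterCode n t p l)) :=
  ⟨fun i hi hit => by rw [exponentOf_apply, clusterCode, if_pos hit, if_neg hi.ne'],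
    fun i j hi hij => h.clusterCode_normal hi hij j.2⟩

theorem exists_linearIndependent_IComponent (m d : ℕ) (hn : 4 ≤ m + 4) :
    ∃ v : admSet (m + 4) d → IComponent (m + 4) hn d, LinearIndependent ℂ v := by
  choose t p c h using fun l : admSet (m + 4) d => l.2.2.2.exists_clustered l.2.1.1
  have ht : ∀ l, t l = 0 ∨ t l = 2 ∨ t l = 3 := fun l => by
    have := (h l).cluster
    omega
  have := (finite_admSet (m + 4) d).to_subtype
  have hli := linearIndependent_symDisc t
    (fun l => exponentOf (m + 4) (clusterCode (m + 4) (t l) (p l) l)) ht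
    (fun l => isNormal_clusterCode (h l)) (fun l l' hll ha => by
      have h' := h l'
      rw [← hll] at ha h'
      refine Subtype.ext ((h l).eq_of_clusterCode_eq h' l.2.1.2 l'.2.1.2 fun j hj => ?_)
      exact DFunLike.congr_fun ha ⟨j, hj⟩)
  refine ⟨fun l => ⟨_, (mem_IComponent hn).2 ⟨symDisc_isSymmetric (t l) _,
    rename_pairMap_symDisc (by have := ht l; omega) _, symDisc_isHomogeneous ?_⟩⟩,
    LinearIndependent.of_comp (IComponent (m + 4) hn d).subtype hli⟩
  simp only [exponentOf_apply]
  rw [Fin.sum_univ_eq_sum_range, (h l).sum_clusterCode, l.2.2.1]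

theorem exists_injective_IComponent (m d : ℕ) (hn : 4 ≤ m + 4) :
    ∃ φ : IComponent (m + 4) hn d →ₗ[ℂ] (admSet (m + 4) d → ℂ), Function.Injective φ := by
  refine ⟨LinearMap.pi fun l => (lcoeff ℂ (exponentOf (m + 4) l)).comp
    (IComponent (m + 4) hn d).subtype, ?_⟩
  rw [injective_iff_map_eq_zero]
  intro f hf
  by_contra hne
  obtain ⟨hs, h0, hh⟩ := (mem_IComponent hn).1 f.2
  obtain ⟨l, hl, hadm, hc⟩ := exists_admissible_coeff_ne_zero hs h0 fun h => hne (Subtype.ext h)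
  refine hc (congrFun hf ⟨l, hl, ?_, hadm⟩)
  have hdeg : (exponentOf (m + 4) l).degree = d := by
    rw [Finsupp.degree_eq_weight_one]
    exact hh hc
  rw [Finsupp.degree_eq_sum] at hdeg
  simpa only [exponentOf_apply, Fin.sum_univ_eq_sum_range] using hdeg

end Assembly

theorem dim_In_eq_admissible_count (n : ℕ) (hn : 4 ≤ n) (d : ℕ) :
    Module.finrank ℂ (IComponent n hn d) = admCount n d := by
  obtain ⟨m, rfl⟩ := Nat.exists_eq_add_of_le' hn
  have := (finite_admSet (m + 4) d).to_subtype
  have := Fintype.ofFinite (admSet (m + 4) d)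
  obtain ⟨φ, hφ⟩ := exists_injective_IComponent m d hn
  obtain ⟨v, hv⟩ := exists_linearIndependent_IComponent m d hn
  have := Module.Finite.of_injective φ hφ
  have hcard : admCount (m + 4) d = Fintype.card (admSet (m + 4) d) := by
    rw [← Nat.card_eq_fintype_card]
    rfl
  rw [hcard]
  refine le_antisymm ?_ hv.fintype_card_le_finrank
  rw [← Module.finrank_fintype_fun_eq_card ℂ (η := admSet (m + 4) d)]
  exact LinearMap.finrank_le_finrank_of_injective hφ
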